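/- (Lower bound on the width needed to fit the sawtooth.) Let P ≥ 1 be an integer and let f(x) = Σ_{k=1}^n a_k · max(w_k·x + b_k, 0) be a one-hidden-layer univariate ReLU network with n hidden units (a_k, w_k, b_k ∈ ℝ). If f(x) equals the distance from x to the nearest even integer for every x ∈ [0, 2P] (i.e., f perfectly fits the sawtooth with P peaks on [0, 2P]), then n ≥ 2P − 1. -/

import Mathlib

open Filter Topology in
/-- Away from its kink a ReLU unit has vanishing symmetric second differences at small scales. -/
theorem eventually_relu_symmetric_difference {w b x : ℝ} (h : w * x + b = 0 → w = 0) :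
    ∀ᶠ t in 𝓝 (0 : ℝ), max (w * (x + t) + b) 0 + max (w * (x - t) + b) 0 =
      2 * max (w * x + b) 0 := by
  have hadd : Tendsto (fun t : ℝ => w * (x + t) + b) (𝓝 0) (𝓝 (w * x + b)) :=
    Continuous.tendsto' (by fun_prop) _ _ (by simp)
  have hsub : Tendsto (fun t : ℝ => w * (x - t) + b) (𝓝 0) (𝓝 (w * x + b)) :=
    Continuous.tendsto' (by fun_prop) _ _ (by simp)
  rcases lt_trichotomy (w * x + b) 0 with hneg | hzero | hpos
  · filter_upwards [hadd.eventually_lt_const hneg, hsub.eventually_lt_const hneg] with t h₁ h₂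
    rw [max_eq_right h₁.le, max_eq_right h₂.le, max_eq_right hneg.le]
    ring
  · filter_upwards with t
    simp only [h hzero, zero_mul]
    ring
  · filter_upwards [hadd.eventually_const_lt hpos, hsub.eventually_const_lt hpos] with t h₁ h₂
    rw [max_eq_left h₁.le, max_eq_left h₂.le, max_eq_left hpos.le]
    ring

theorem abs_sub_two_mul_round_half_eq {x : ℝ} (j : ℤ) (h₁ : 2 * (j : ℝ) - 1 ≤ x)
    (h₂ : x < 2 * j + 1) : |x - 2 * (round (x / 2) : ℤ)| = |x - 2 * j| := by
  have hround : round (x / 2) = j := by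
    rw [round_eq, Int.floor_eq_iff]
    constructor <;> linarith
  rw [hround]

/-- The sawtooth has nonzero symmetric second differences at every integer. -/
theorem sawtooth_symmetric_difference_ne (m : ℤ) {t : ℝ} (ht : 0 < t) (ht' : t < 1) :
    |(m + t) - 2 * (round ((m + t) / 2) : ℤ)| + |(m - t) - 2 * (round ((m - t) / 2) : ℤ)| ≠
      2 * |(m : ℝ) - 2 * (round ((m : ℝ) / 2) : ℤ)| := by
  obtain ⟨j, rfl | rfl⟩ := Int.even_or_odd' m
  · push_cast
    rw [abs_sub_two_mul_round_half_eq j (by linarith) (by linarith),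
      abs_sub_two_mul_round_half_eq j (by linarith) (by linarith),
      abs_sub_two_mul_round_half_eq j (by linarith) (by linarith),
      abs_of_pos (by linarith), abs_of_neg (by linarith), sub_self, abs_zero]
    linarith
  · push_cast
    rw [abs_sub_two_mul_round_half_eq (j + 1) (by push_cast; linarith) (by push_cast; linarith),
      abs_sub_two_mul_round_half_eq j (by linarith) (by linarith),
      abs_sub_two_mul_round_half_eq (j + 1) (by push_cast; linarith) (by push_cast; linarith)]
    push_cast
    rw [abs_of_neg (by linarith), abs_of_pos (by linarith), abs_of_neg (by linarith)]
    linarith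

/-- Lower bound on the width needed to fit the sawtooth: if a one-hidden-layer
univariate ReLU network with `n` hidden units equals the sawtooth with `P`
peaks (the distance from `x` to the nearest even integer) on all of `[0, 2P]`,
then `n ≥ 2P − 1`. -/
theorem sawtooth_width_lower_bound
    (P : ℕ) (hP : 1 ≤ P) (n : ℕ) (a w b : Fin n → ℝ)
    (hfit : ∀ x ∈ Set.Icc (0 : ℝ) (2 * P),
      (∑ k : Fin n, a k * max (w k * x + b k) 0) =
        |x - 2 * (round (x / 2) : ℤ)|) :
    2 * P - 1 ≤ n := by
  have hkink : ∀ i : Fin (2 * P - 1), ∃ k, w k * ((i : ℕ) + 1 : ℝ) + b k = 0 ∧ w k ≠ 0 := by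
    intro i
    by_contra! hno
    have hlt : ((i : ℕ) + 2 : ℝ) ≤ 2 * P := by
      have := i.isLt
      exact_mod_cast (by omega : (i : ℕ) + 2 ≤ 2 * P)
    have hnonneg : (0 : ℝ) ≤ (i : ℕ) := Nat.cast_nonneg _
    have hev : ∀ᶠ t in nhdsWithin (0 : ℝ) (Set.Ioi 0), ∀ k, _ := nhdsWithin_le_nhds
      (Filter.eventually_all.2 fun k => eventually_relu_symmetric_difference (hno k))
    obtain ⟨t, hunits, ht, ht'⟩ :=
      (hev.and (Ioo_mem_nhdsGT (zero_lt_one : (0 : ℝ) < 1))).exists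
    have hne := sawtooth_symmetric_difference_ne ((i : ℕ) + 1) ht ht'
    push_cast at hne
    rw [← hfit _ ⟨by linarith, by linarith⟩, ← hfit _ ⟨by linarith, by linarith⟩,
      ← hfit _ ⟨by linarith, by linarith⟩, ← Finset.sum_add_distrib, Finset.mul_sum] at hne
    refine hne (Finset.sum_congr rfl fun k _ => ?_)
    rw [← mul_add, hunits k]
    ring
  choose unit hzero hslope using hkink
  have hinj : Function.Injective unit := by
    intro i j hij
    have hi := hzero i
    rw [hij] at hi
    have heq : ((i : ℕ) + 1 : ℝ) = (j : ℕ) + 1 :=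
      mul_left_cancel₀ (hslope j) (by linarith [hzero j])
    exact Fin.ext (by exact_mod_cast add_right_cancel heq)
  simpa using Fintype.card_le_of_injective unit hinj
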